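/- Let θ* ∈ ℝ^p be nonzero with support S := supp(θ*), k := |S|, and θmin := min_{j∈S} |θ*_j|. Let Q⁰ ∈ ℝ^{p×p} be symmetric with λmin(Q⁰_{S,S}) ≥ Cmin for some Cmin > 0, and suppose ‖Q⁰_{S^c,S} (Q⁰_{S,S})⁻¹‖∞ ≤ 1 − α for some α ∈ (0,1]. Let Q̂ ∈ ℝ^{p×p} be symmetric positive semidefinite, Ĝ ∈ ℝ^p, λ > 0, and define L(θ) := (1/2)(θ − θ*)ᵀ Q̂ (θ − θ*) − ⟨Ĝ, θ − θ*⟩. If (i) ‖Ĝ‖∞ ≤ λα/3, (ii) ‖Ĝ_S‖∞ ≤ θmin·Cmin/(4k) − λ, (iii) ‖Q̂_{S^c,S} − Q⁰_{S^c,S}‖∞ ≤ (α/12)·Cmin/√k, and (iv) ‖Q̂_{S,S} − Q⁰_{S,S}‖∞ ≤ (α/12)·Cmin/√k, then every minimizer θ̂ of θ ↦ L(θ) + λ‖θ‖₁ over ℝ^p satisfies sign(θ̂) = sign(θ*). -/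

import Mathlib

open scoped Matrix

/-- The `ℓ∞` operator norm of a real matrix: maximum over rows of the sum of
absolute values of the entries. -/
noncomputable def matInfNorm {I J : Type*} [Fintype I] [Fintype J]
    (A : Matrix I J ℝ) : ℝ :=
  ⨆ i, ∑ j, |A i j|

/-- The submatrix of `A` with rows indexed by `S` and columns indexed by `T`. -/
def subm {p : ℕ} (A : Matrix (Fin p) (Fin p) ℝ) (S T : Finset (Fin p)) :
    Matrix S T ℝ :=
  A.submatrix (fun i => (i : Fin p)) (fun j => (j : Fin p))

/-- The smallest eigenvalue of a real symmetric matrix, characterized as the infimum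
of the Rayleigh quotient over unit vectors. -/
noncomputable def lambdaMin {I : Type*} [Fintype I] (A : Matrix I I ℝ) : ℝ :=
  sInf { r : ℝ | ∃ x : I → ℝ, ∑ i, (x i) ^ 2 = 1 ∧ r = x ⬝ᵥ A.mulVec x }

theorem aux_row {I J : Type*} [Fintype I] [Fintype J] (A : Matrix I J ℝ) (i : I) :
    ∑ j, |A i j| ≤ matInfNorm A :=
  le_ciSup (f := fun i => ∑ j, |A i j|) (Set.finite_range _).bddAbove i

theorem aux_mulVec {I J : Type*} [Fintype I] [Fintype J] (A : Matrix I J ℝ) (x : J → ℝ)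
    (B c : ℝ) (hB : 0 ≤ B) (hx : ∀ j, |x j| ≤ B) (hA : matInfNorm A ≤ c) (i : I) :
    |A.mulVec x i| ≤ c * B := by
  calc |A.mulVec x i| ≤ ∑ j, |A i j * x j| := Finset.abs_sum_le_sum_abs _ _
    _ ≤ ∑ j, |A i j| * B := by
        apply Finset.sum_le_sum
        intro j _
        rw [abs_mul]
        exact mul_le_mul_of_nonneg_left (hx j) (abs_nonneg _)
    _ = (∑ j, |A i j|) * B := by rw [Finset.sum_mul]
    _ ≤ c * B := mul_le_mul_of_nonneg_right ((aux_row A i).trans hA) hB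

theorem aux_quad {I : Type*} [Fintype I] (A : Matrix I I ℝ) (hs : ∀ i j, A i j = A j i)
    (c : ℝ) (hA : matInfNorm A ≤ c) (x : I → ℝ) :
    |x ⬝ᵥ A.mulVec x| ≤ c * ∑ i, x i ^ 2 := by
  have h1 : |x ⬝ᵥ A.mulVec x| ≤ ∑ i, ∑ j, |A i j| * ((x i ^ 2 + x j ^ 2) / 2) := by
    refine (Finset.abs_sum_le_sum_abs _ _).trans ?_
    apply Finset.sum_le_sum
    intro i _
    rw [Matrix.mulVec, dotProduct, Finset.mul_sum]
    refine (Finset.abs_sum_le_sum_abs _ _).trans ?_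
    apply Finset.sum_le_sum
    intro j _
    have : |x i * (A i j * x j)| = |A i j| * (|x i| * |x j|) := by
      rw [abs_mul, abs_mul]; ring
    rw [this]
    apply mul_le_mul_of_nonneg_left _ (abs_nonneg _)
    nlinarith [sq_nonneg (|x i| - |x j|), sq_abs (x i), sq_abs (x j)]
  have h2 : ∑ i, ∑ j, |A i j| * ((x i ^ 2 + x j ^ 2) / 2)
      = ∑ i, (∑ j, |A i j|) * x i ^ 2 := by
    have e1 : ∑ i, ∑ j, |A i j| * ((x i ^ 2 + x j ^ 2) / 2)
        = ∑ i, ∑ j, |A i j| * x i ^ 2 / 2 + ∑ i, ∑ j, |A i j| * x j ^ 2 / 2 := by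
      rw [← Finset.sum_add_distrib]
      apply Finset.sum_congr rfl
      intro i _
      rw [← Finset.sum_add_distrib]
      apply Finset.sum_congr rfl
      intro j _
      ring
    have e2 : ∑ i, ∑ j, |A i j| * x j ^ 2 / 2 = ∑ i, ∑ j, |A i j| * x i ^ 2 / 2 := by
      rw [Finset.sum_comm]
      apply Finset.sum_congr rfl
      intro i _
      apply Finset.sum_congr rfl
      intro j _
      rw [hs j i]
    rw [e1, e2, ← Finset.sum_add_distrib]
    apply Finset.sum_congr rfl
    intro i _
    rw [← Finset.sum_add_distrib, Finset.sum_mul]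
    apply Finset.sum_congr rfl
    intro j _
    ring
  rw [h2] at h1
  refine h1.trans ?_
  rw [Finset.mul_sum]
  apply Finset.sum_le_sum
  intro i _
  exact mul_le_mul_of_nonneg_right ((aux_row A i).trans hA) (sq_nonneg _)

theorem aux_lmin {I : Type*} [Fintype I] (A : Matrix I I ℝ) (C : ℝ) (hC : 0 < C)
    (h : C ≤ lambdaMin A) (x : I → ℝ) : C * ∑ i, x i ^ 2 ≤ x ⬝ᵥ A.mulVec x := by
  have hb : BddBelow { r : ℝ | ∃ x : I → ℝ, ∑ i, (x i) ^ 2 = 1 ∧ r = x ⬝ᵥ A.mulVec x } := by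
    by_contra hb
    have := Real.sInf_of_not_bddBelow hb
    unfold lambdaMin at h
    linarith
  have hn : 0 ≤ ∑ i, x i ^ 2 := Finset.sum_nonneg fun i _ => sq_nonneg _
  rcases hn.eq_or_lt with h0 | hpos
  · have hx : x = 0 := by
      funext i
      have := (Finset.sum_eq_zero_iff_of_nonneg (fun i _ => sq_nonneg (x i))).1 h0.symm i
        (Finset.mem_univ i)
      simpa using this
    simp [hx]
  · set n := ∑ i, x i ^ 2 with hndef
    set t := Real.sqrt n with ht
    have htp : 0 < t := Real.sqrt_pos.2 hpos
    have htt : t * t = n := Real.mul_self_sqrt hn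
    have hu : ∑ i, ((t⁻¹ • x) i) ^ 2 = 1 := by
      simp only [Pi.smul_apply, smul_eq_mul, mul_pow]
      rw [← Finset.mul_sum, ← hndef, ← htt]
      field_simp
    have h3 := h.trans (csInf_le hb ⟨t⁻¹ • x, hu, rfl⟩)
    rw [Matrix.mulVec_smul, smul_dotProduct, dotProduct_smul, smul_eq_mul, smul_eq_mul] at h3
    have h4 := mul_le_mul_of_nonneg_right h3 hn
    calc C * n ≤ _ := h4
      _ = _ := by rw [← htt]; field_simp

theorem aux_unit {I : Type*} [Fintype I] [DecidableEq I] (A : Matrix I I ℝ) (C : ℝ) (hC : 0 < C)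
    (h : ∀ x : I → ℝ, C * ∑ i, x i ^ 2 ≤ x ⬝ᵥ A.mulVec x) : IsUnit A := by
  rw [← Matrix.mulVec_injective_iff_isUnit]
  intro x y hxy
  have h0 : A.mulVec (x - y) = 0 := by
    rw [Matrix.mulVec_sub]; exact sub_eq_zero.2 hxy
  have h1 := h (x - y)
  rw [h0, dotProduct_zero] at h1
  have h2 : 0 ≤ ∑ i, (x - y) i ^ 2 := Finset.sum_nonneg fun i _ => sq_nonneg _
  have h3 : ∑ i, (x - y) i ^ 2 = 0 := by nlinarith
  funext i
  have := (Finset.sum_eq_zero_iff_of_nonneg (fun i _ => sq_nonneg ((x - y) i))).1 h3 i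
    (Finset.mem_univ i)
  have h5 : (x - y) i = 0 := by simpa using this
  exact sub_eq_zero.1 h5

theorem aux_bound {I : Type*} [Fintype I] (A : Matrix I I ℝ) (C : ℝ)
    (h : ∀ x : I → ℝ, C * ∑ i, x i ^ 2 ≤ x ⬝ᵥ A.mulVec x) (hC : 0 < C)
    (x : I → ℝ) (R : ℝ) (hR : ∀ i, |A.mulVec x i| ≤ R) (i : I) :
    C * |x i| ≤ R * Real.sqrt (Fintype.card I) := by
  have hR0 : 0 ≤ R := (abs_nonneg _).trans (hR i)
  set n := ∑ i, x i ^ 2 with hndef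
  have hn : 0 ≤ n := Finset.sum_nonneg fun i _ => sq_nonneg _
  set m := Real.sqrt n with hm
  have hmm : m * m = n := Real.mul_self_sqrt hn
  have hm0 : 0 ≤ m := Real.sqrt_nonneg _
  have hxm : |x i| ≤ m := by
    apply Real.abs_le_sqrt
    exact Finset.single_le_sum (f := fun i => x i ^ 2) (fun i _ => sq_nonneg _) (Finset.mem_univ i)
  have h1 : x ⬝ᵥ A.mulVec x ≤ (∑ i, |x i|) * R := by
    rw [Finset.sum_mul]
    apply Finset.sum_le_sum
    intro j _
    refine (le_abs_self _).trans ?_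
    rw [abs_mul]
    exact mul_le_mul_of_nonneg_left (hR j) (abs_nonneg _)
  have h2 : ∑ i, |x i| ≤ Real.sqrt (Fintype.card I) * m := by
    rw [hm, ← Real.sqrt_mul (Nat.cast_nonneg _)]
    apply Real.le_sqrt_of_sq_le
    have := sq_sum_le_card_mul_sum_sq (s := (Finset.univ : Finset I)) (f := fun i => |x i|)
    simpa [sq_abs] using this
  have h3 : C * m * m ≤ R * Real.sqrt (Fintype.card I) * m := by
    have := h x
    have h4 := mul_le_mul_of_nonneg_right h2 hR0
    rw [← hndef, ← hmm] at this
    nlinarith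
  have h5 : C * m ≤ R * Real.sqrt (Fintype.card I) := by
    rcases hm0.eq_or_lt with h0 | hp
    · rw [← h0, mul_zero]; positivity
    · exact le_of_mul_le_mul_right h3 hp
  exact (mul_le_mul_of_nonneg_left hxm hC.le).trans h5

/-- Strict dual feasibility implies uniqueness of the minimizer. -/
theorem aux_pdw {p : ℕ} (S : Finset (Fin p)) (Q : Matrix (Fin p) (Fin p) ℝ) (hQ : Q.PosSemidef)
    (c : ℝ) (hc : 0 < c)
    (hc2 : ∀ x : S → ℝ, c * ∑ i, x i ^ 2 ≤ x ⬝ᵥ (subm Q S S).mulVec x)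
    (G θs D z : Fin p → ℝ) (lam : ℝ) (hlam : 0 < lam)
    (hz : ∀ j, lam * z j = G j - Q.mulVec D j)
    (hz1 : ∀ j, |z j| ≤ 1) (hz2 : ∀ j, j ∉ S → |z j| < 1)
    (hzt : ∀ j, z j * (θs + D) j = |(θs + D) j|)
    (hoff : ∀ j, j ∉ S → (θs + D) j = 0)
    (θh : Fin p → ℝ)
    (hmin : (1 / 2) * ((θh - θs) ⬝ᵥ Q.mulVec (θh - θs)) - G ⬝ᵥ (θh - θs)
            + lam * ∑ j, |θh j|
          ≤ (1 / 2) * (D ⬝ᵥ Q.mulVec D) - G ⬝ᵥ D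
            + lam * ∑ j, |(θs + D) j|) : θh = θs + D := by
  set d := θh - (θs + D) with hd
  have e1 : θh - θs = D + d := by rw [hd]; abel
  have hsym : D ⬝ᵥ Q.mulVec d = d ⬝ᵥ Q.mulVec D := by
    rw [Matrix.dotProduct_mulVec, ← Matrix.mulVec_transpose, dotProduct_comm]
    have : Qᵀ = Q := by simpa using hQ.isHermitian.eq
    rw [this]
  have hG : G ⬝ᵥ d = lam * (z ⬝ᵥ d) + d ⬝ᵥ Q.mulVec D := by
    simp only [dotProduct]
    rw [Finset.mul_sum, ← Finset.sum_add_distrib]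
    apply Finset.sum_congr rfl
    intro j _
    have := hz j
    linear_combination (-(d j)) * this
  have hzd : z ⬝ᵥ d = ∑ j, z j * θh j - ∑ j, |(θs + D) j| := by
    simp only [dotProduct, ← hzt]
    rw [← Finset.sum_sub_distrib]
    apply Finset.sum_congr rfl
    intro j _
    simp only [hd, Pi.sub_apply]
    ring
  have hq : 0 ≤ d ⬝ᵥ Q.mulVec d := by simpa using hQ.dotProduct_mulVec_nonneg d
  rw [e1, Matrix.mulVec_add, add_dotProduct, dotProduct_add, dotProduct_add, dotProduct_add, hsym,
    hG, hzd] at hmin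
  have hterm : ∀ j, 0 ≤ |θh j| - z j * θh j := by
    intro j
    have h1 := le_abs_self (z j * θh j)
    rw [abs_mul] at h1
    nlinarith [hz1 j, abs_nonneg (θh j)]
  have hs0 : 0 ≤ ∑ j, (|θh j| - z j * θh j) := Finset.sum_nonneg fun j _ => hterm j
  have hsum : 1 / 2 * (d ⬝ᵥ Q.mulVec d) + lam * ∑ j, (|θh j| - z j * θh j) ≤ 0 := by
    rw [Finset.sum_sub_distrib]
    linarith
  have hsz : ∑ j, (|θh j| - z j * θh j) = 0 := by
    have := mul_nonneg hlam.le hs0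
    nlinarith
  have hqz : d ⬝ᵥ Q.mulVec d = 0 := by
    rw [hsz] at hsum; linarith
  have hoffh : ∀ j, j ∉ S → θh j = 0 := by
    intro j hj
    have h1 := (Finset.sum_eq_zero_iff_of_nonneg (fun j _ => hterm j)).1 hsz j (Finset.mem_univ j)
    by_contra hne
    have h2 : 0 < |θh j| := abs_pos.2 hne
    have h3 := le_abs_self (z j * θh j)
    rw [abs_mul] at h3
    nlinarith [hz2 j hj]
  have hd0 : ∀ j, j ∉ S → d j = 0 := by
    intro j hj
    rw [hd, Pi.sub_apply, hoffh j hj, hoff j hj, sub_zero]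
  have hdS := hc2 (fun i : S => d i)
  have hEq : (fun i : S => d i) ⬝ᵥ (subm Q S S).mulVec (fun i : S => d i) = d ⬝ᵥ Q.mulVec d := by
    simp only [dotProduct, Matrix.mulVec, subm, Matrix.submatrix_apply]
    have inner : ∀ i, ∑ j : S, Q i j * d j = ∑ j, Q i j * d j := by
      intro i
      rw [Finset.sum_coe_sort S (fun j => Q i j * d j)]
      apply Finset.sum_subset (Finset.subset_univ _)
      intro j _ hj
      rw [hd0 j hj, mul_zero]
    simp only [inner]
    rw [Finset.sum_coe_sort S (fun i => d i * ∑ j, Q i j * d j)]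
    apply Finset.sum_subset (Finset.subset_univ _)
    intro j _ hj
    rw [hd0 j hj, zero_mul]
  rw [hEq, hqz] at hdS
  have h2 : 0 ≤ ∑ i : S, d i ^ 2 := Finset.sum_nonneg fun i _ => sq_nonneg _
  have h3 : ∑ i : S, d i ^ 2 = 0 := by nlinarith
  have hdz : d = 0 := by
    funext j
    by_cases hj : j ∈ S
    · have := (Finset.sum_eq_zero_iff_of_nonneg (fun (i : S) _ => sq_nonneg (d i))).1 h3 ⟨j, hj⟩
        (Finset.mem_univ _)
      simpa using this
    · exact hd0 j hj
  exact sub_eq_zero.1 hdz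

set_option maxHeartbeats 1600000 in
theorem stmt2 {p : ℕ} (θstar : Fin p → ℝ) (hne : θstar ≠ 0)
    (S : Finset (Fin p)) (hS : ∀ j, j ∈ S ↔ θstar j ≠ 0)
    (θmin : ℝ) (hθmin : θmin = ⨅ j : S, |θstar j|)
    (Q0 : Matrix (Fin p) (Fin p) ℝ) (hQ0sym : Q0.IsHermitian)
    (Cmin : ℝ) (hCminpos : 0 < Cmin)
    (hlmin : Cmin ≤ lambdaMin (subm Q0 S S))
    (α : ℝ) (hα : 0 < α) (hα1 : α ≤ 1)
    (hirr : matInfNorm (subm Q0 Sᶜ S * (subm Q0 S S)⁻¹) ≤ 1 - α)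
    (Qh : Matrix (Fin p) (Fin p) ℝ) (hQh : Qh.PosSemidef)
    (Gh : Fin p → ℝ) (lam : ℝ) (hlam : 0 < lam)
    (hG1 : ∀ j, |Gh j| ≤ lam * α / 3)
    (hG2 : ∀ j ∈ S, |Gh j| ≤ θmin * Cmin / (4 * S.card) - lam)
    (hQ1 : matInfNorm (subm (Qh - Q0) Sᶜ S) ≤ α / 12 * (Cmin / Real.sqrt S.card))
    (hQ2 : matInfNorm (subm (Qh - Q0) S S) ≤ α / 12 * (Cmin / Real.sqrt S.card)) :
    ∀ θh : Fin p → ℝ,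
      (∀ θ : Fin p → ℝ,
        (1 / 2) * ((θh - θstar) ⬝ᵥ Qh.mulVec (θh - θstar)) - Gh ⬝ᵥ (θh - θstar)
            + lam * ∑ j, |θh j|
          ≤ (1 / 2) * ((θ - θstar) ⬝ᵥ Qh.mulVec (θ - θstar)) - Gh ⬝ᵥ (θ - θstar)
            + lam * ∑ j, |θ j|) →
      ∀ j, Real.sign (θh j) = Real.sign (θstar j) := by
  intro θh hmin
  obtain ⟨j0, hj0⟩ : ∃ j, θstar j ≠ 0 := by
    by_contra hcon
    push Not at hcon
    exact hne (funext hcon)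
  have hj0S : j0 ∈ S := (hS j0).2 hj0
  have : Nonempty S := ⟨⟨j0, hj0S⟩⟩
  have hkpos : 0 < S.card := Finset.card_pos.2 ⟨j0, hj0S⟩
  have hk1 : (1 : ℝ) ≤ S.card := by exact_mod_cast hkpos
  set k : ℝ := (S.card : ℝ) with hk
  set q := Real.sqrt k with hq
  have hq1 : 1 ≤ q := by rw [hq]; exact Real.one_le_sqrt.2 hk1
  have hqq : q * q = k := Real.mul_self_sqrt (by linarith)
  have hqpos : 0 < q := by linarith
  -- θmin
  have hθle : ∀ j ∈ S, θmin ≤ |θstar j| := by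
    intro j hj
    rw [hθmin]
    exact ciInf_le (f := fun j : S => |θstar j|) (Set.finite_range _).bddBelow ⟨j, hj⟩
  have hθpos : 0 < θmin := by
    obtain ⟨i, hi⟩ := exists_eq_ciInf_of_finite (f := fun j : S => |θstar j|)
    rw [hθmin, ← hi]
    exact abs_pos.2 ((hS i).1 i.2)
  set ε := α / 12 * (Cmin / q) with hε
  have hεq : ε * q = α / 12 * Cmin := by rw [hε]; field_simp
  have hεpos : 0 < ε := by positivity
  have hεC : ε ≤ Cmin / 12 := by nlinarith
  have hquad0 := aux_lmin _ Cmin hCminpos hlmin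
  have hsplit : ∀ T : Finset (Fin p), subm Qh T S = subm Q0 T S + subm (Qh - Q0) T S := by
    intro T
    ext i j
    simp [subm]
  have hEsym : ∀ i j, subm (Qh - Q0) S S i j = subm (Qh - Q0) S S j i := by
    intro i j
    have := (hQh.isHermitian.sub hQ0sym).apply (i : Fin p) j
    simpa [subm] using this.symm
  set c := 11 / 12 * Cmin with hc
  have hcpos : 0 < c := by positivity
  have hquad : ∀ x : S → ℝ, c * ∑ i, x i ^ 2 ≤ x ⬝ᵥ (subm Qh S S).mulVec x := by
    intro x
    rw [hsplit S, Matrix.add_mulVec, dotProduct_add]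
    have h1 := hquad0 x
    have h2 := (abs_le.1 (aux_quad _ hEsym ε hQ2 x)).1
    have h3 : 0 ≤ ∑ i, x i ^ 2 := Finset.sum_nonneg fun i _ => sq_nonneg _
    nlinarith
  have hu0 := aux_unit _ Cmin hCminpos hquad0
  have hu := aux_unit _ c hcpos hquad
  -- right hand side
  set r : S → ℝ := fun i => Gh i - lam * Real.sign (θstar i) with hr
  obtain ⟨Δ, hΔ⟩ := (Matrix.mulVec_surjective_iff_isUnit.2 hu) r
  have hsign : ∀ j, |Real.sign (θstar j)| ≤ 1 := by
    intro j
    rcases Real.sign_apply_eq (θstar j) with h | h | h <;> rw [h] <;> simp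
  have hrG : ∀ i : S, |r i| ≤ |Gh i| + lam := by
    intro i
    have h1 := abs_sub (Gh i) (lam * Real.sign (θstar i))
    rw [abs_mul, abs_of_pos hlam] at h1
    have := mul_le_mul_of_nonneg_left (hsign i) hlam.le
    simp only [hr]
    linarith
  have hcard : (Fintype.card S : ℝ) = k := by simp [hk]
  have hb1 : ∀ i, c * |Δ i| ≤ θmin * Cmin / (4 * k) * q := by
    intro i
    have := aux_bound _ c hquad hcpos Δ (θmin * Cmin / (4 * k)) (by
      intro i
      rw [hΔ]
      have := hG2 i i.2
      linarith [hrG i]) i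
    rwa [hcard] at this
  have hb2 : ∀ i, c * |Δ i| ≤ (lam * α / 3 + lam) * q := by
    intro i
    have := aux_bound _ c hquad hcpos Δ (lam * α / 3 + lam) (by
      intro i
      rw [hΔ]
      have := hG1 i
      linarith [hrG i]) i
    rwa [hcard] at this
  have hsmall : ∀ i, |Δ i| < θmin := by
    intro i
    have h1 := hb1 i
    have h2 : θmin * Cmin / (4 * k) * q ≤ θmin * Cmin / 4 := by
      rw [← hqq]
      have : θmin * Cmin / (4 * (q * q)) * q = θmin * Cmin / 4 / q := by field_simp
      rw [this]
      exact div_le_self (by positivity) hq1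
    have h3 : 0 < θmin * Cmin := by positivity
    by_contra hcon
    push Not at hcon
    have := mul_le_mul_of_nonneg_left hcon hcpos.le
    rw [hc] at *
    nlinarith
  set B := (lam * α / 3 + lam) * q / c with hB
  have hBpos : 0 < B := by positivity
  have hΔB : ∀ i, |Δ i| ≤ B := by
    intro i
    rw [hB, le_div_iff₀ hcpos]
    linarith [hb2 i]
  have hεB : ε * B ≤ 4 / 33 * (α * lam) := by
    have : ε * B = (α / 11) * (lam * α / 3 + lam) := by
      rw [hB, hε, hc]; field_simp
    rw [this]
    have : 0 < α * lam := by positivity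
    nlinarith
  -- extension by zero
  set D : Fin p → ℝ := fun j => if h : j ∈ S then Δ ⟨j, h⟩ else 0 with hD
  have hDS : ∀ i : S, D i = Δ i := by
    intro i
    simp [hD]
  have hDoff : ∀ j, j ∉ S → D j = 0 := by
    intro j hj
    simp [hD, hj]
  have hQD : ∀ i, Qh.mulVec D i = ∑ j : S, Qh i j * Δ j := by
    intro i
    simp only [← hDS]
    rw [Finset.sum_coe_sort S (fun j => Qh i j * D j)]
    symm
    apply Finset.sum_subset (Finset.subset_univ _)
    intro j _ hj
    rw [hDoff j hj, mul_zero]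
  have hoff0 : ∀ j, j ∉ S → θstar j = 0 := by
    intro j hj
    by_contra hcon
    exact hj ((hS j).2 hcon)
  set z : Fin p → ℝ := fun j => (Gh j - Qh.mulVec D j) / lam with hzdef
  have hz : ∀ j, lam * z j = Gh j - Qh.mulVec D j := by
    intro j
    simp only [hzdef]
    field_simp
  have hzS : ∀ j ∈ S, z j = Real.sign (θstar j) := by
    intro j hj
    have h1 := congrFun hΔ ⟨j, hj⟩
    have h2 : Qh.mulVec D j = r ⟨j, hj⟩ := by
      rw [hQD, ← h1]
      rfl
    have h3 := hz j
    rw [h2] at h3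
    simp only [hr] at h3
    have : lam * z j = lam * Real.sign (θstar j) := by linarith
    exact mul_left_cancel₀ hlam.ne' this
  have hz2 : ∀ j, j ∉ S → |z j| < 1 := by
    intro j hj
    have hjc : j ∈ Sᶜ := Finset.mem_compl.2 hj
    set M := subm Q0 Sᶜ S * (subm Q0 S S)⁻¹ with hM
    have hMQ : M * subm Q0 S S = subm Q0 Sᶜ S := by
      rw [hM, Matrix.mul_assoc, Matrix.nonsing_inv_mul _ ((Matrix.isUnit_iff_isUnit_det _).1 hu0),
        Matrix.mul_one]
    have h1 : Qh.mulVec D j = (subm Qh Sᶜ S).mulVec Δ ⟨j, hjc⟩ := by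
      rw [hQD]
      rfl
    have hE1 := aux_mulVec _ Δ B ε hBpos.le hΔB hQ1 ⟨j, hjc⟩
    have hE2 := aux_mulVec _ Δ B ε hBpos.le hΔB hQ2
    have h0 : ∀ i, |(subm Q0 S S).mulVec Δ i| ≤ lam * α / 3 + lam + ε * B := by
      intro i
      have e := congrFun hΔ i
      rw [hsplit S, Matrix.add_mulVec, Pi.add_apply] at e
      have e' : (subm Q0 S S).mulVec Δ i = r i - (subm (Qh - Q0) S S).mulVec Δ i := by linarith
      rw [e']
      have := abs_sub (r i) ((subm (Qh - Q0) S S).mulVec Δ i)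
      linarith [hrG i, hG1 i, hE2 i]
    have hMb := aux_mulVec M ((subm Q0 S S).mulVec Δ) (lam * α / 3 + lam + ε * B) (1 - α)
      (by positivity) h0 hirr ⟨j, hjc⟩
    rw [Matrix.mulVec_mulVec, hMQ] at hMb
    rw [hsplit, Matrix.add_mulVec, Pi.add_apply] at h1
    have hlz : |lam * z j| < lam := by
      rw [hz, h1]
      have t1 := abs_sub (Gh j) ((subm Q0 Sᶜ S).mulVec Δ ⟨j, hjc⟩
        + (subm (Qh - Q0) Sᶜ S).mulVec Δ ⟨j, hjc⟩)
      have t2 := abs_add_le ((subm Q0 Sᶜ S).mulVec Δ ⟨j, hjc⟩)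
        ((subm (Qh - Q0) Sᶜ S).mulVec Δ ⟨j, hjc⟩)
      have t3 := hG1 j
      have t4 : (1 - α) * (lam * α / 3 + lam + ε * B)
          ≤ (1 - α) * (lam * α / 3 + lam + 4 / 33 * (α * lam)) :=
        mul_le_mul_of_nonneg_left (by linarith) (by linarith)
      have t5 : 0 < α * lam := by positivity
      have t6 : 0 < α * (α * lam) := by positivity
      nlinarith
    rw [abs_mul, abs_of_pos hlam] at hlz
    by_contra hcon
    push Not at hcon
    nlinarith
  have hz1 : ∀ j, |z j| ≤ 1 := by
    intro j
    by_cases hj : j ∈ S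
    · rw [hzS j hj]; exact hsign j
    · exact (hz2 j hj).le
  have hsg : ∀ j, Real.sign ((θstar + D) j) = Real.sign (θstar j) := by
    intro j
    by_cases hj : j ∈ S
    · have h1 := hθle j hj
      have h2 := hsmall ⟨j, hj⟩
      rw [← hDS] at h2
      have h3 := abs_lt.1 (h2.trans_le h1)
      simp only [Pi.add_apply]
      rcases lt_or_gt_of_ne ((hS j).1 hj) with hn | hp
      · rw [abs_of_neg hn] at h3
        rw [Real.sign_of_neg hn, Real.sign_of_neg (by linarith [h3.2])]
      · rw [abs_of_pos hp] at h3
        rw [Real.sign_of_pos hp, Real.sign_of_pos (by linarith [h3.1])]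
    · simp [hoff0 j hj, hDoff j hj]
  have hoff : ∀ j, j ∉ S → (θstar + D) j = 0 := by
    intro j hj
    simp [hoff0 j hj, hDoff j hj]
  have hzt : ∀ j, z j * (θstar + D) j = |(θstar + D) j| := by
    intro j
    by_cases hj : j ∈ S
    · rw [hzS j hj, ← hsg j]
      rcases lt_trichotomy ((θstar + D) j) 0 with h | h | h
      · rw [Real.sign_of_neg h, abs_of_neg h]; ring
      · rw [h]; simp
      · rw [Real.sign_of_pos h, abs_of_pos h]; ring
    · rw [hoff j hj]; simp
  have hfin := aux_pdw S Qh hQh c hcpos hquad Gh θstar D z lam hlam hz hz1 hz2 hzt hoff θh (by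
    have := hmin (θstar + D)
    simpa only [add_sub_cancel_left] using this)
  intro j
  rw [hfin]
  exact hsg j
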